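/- Let T be a bipartite tournament, v ∉ V(T), and T' a bipartite tournament on V(T) ∪ {v} whose induced subgraph on V(T) is T. Suppose that both T and T' are M-consistent for some M ⊆ V(T), and let (X_1, Y_1, …, X_l, Y_l) be the M-sequence of T. Then there exists an index i such that the M-sequence of T' is either (X_1, Y_1, …, X_i ∪ {v}, …, X_l, Y_l) or (X_1, Y_1, …, Y_i ∪ {v}, …, X_l, Y_l); that is, the M-sequence of T' is obtained from that of T by adding v to exactly one of the sets X_i or Y_i. -/

import Mathlib

open Set

variable {V : Type*}

/-- The arc relation `E` restricted to the vertex set `S` has no directed cycle. -/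
def AcyclicOn (E : V → V → Prop) (S : Set V) : Prop :=
  ∀ v : V, ¬ Relation.TransGen (fun x y => x ∈ S ∧ y ∈ S ∧ E x y) v v

/-- `E` is a bipartite tournament with partite sets `A` and `B`. -/
def IsBipartiteTournament (E : V → V → Prop) (A B : Set V) : Prop :=
  A ∪ B = Set.univ ∧ A ∩ B = ∅ ∧
  (∀ a ∈ A, ∀ b ∈ B, Xor' (E a b) (E b a)) ∧
  (∀ u ∈ A, ∀ v ∈ A, ¬ E u v) ∧
  (∀ u ∈ B, ∀ v ∈ B, ¬ E u v)

/-- `H` is a feedback vertex set: deleting `H` leaves an acyclic digraph. -/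
def IsFVS (E : V → V → Prop) (H : Set V) : Prop := AcyclicOn E Hᶜ

/-- A directed cycle of length 4 (a square) on the distinct vertices `a b c d`. -/
def IsDirSquare (E : V → V → Prop) (a b c d : V) : Prop :=
  a ≠ b ∧ a ≠ c ∧ a ≠ d ∧ b ≠ c ∧ b ≠ d ∧ c ≠ d ∧
  E a b ∧ E b c ∧ E c d ∧ E d a

/-- Out-neighborhood. -/
def OutN (E : V → V → Prop) (v : V) : Set V := {u | E v u}

/-- In-neighborhood. -/
def InN (E : V → V → Prop) (v : V) : Set V := {u | E u v}

/-- The union `X 1 ∪ ⋯ ∪ X (i-1)` of the sets preceding index `i` (1-based). -/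
def SeqPrev (X : ℕ → Set V) (i : ℕ) : Set V := {v | ∃ j, 1 ≤ j ∧ j < i ∧ v ∈ X j}

/-- `X 1, …, X l` is the canonical sequence of the digraph induced by `E` on `S`:
`X i` is the set of vertices with no incoming arc in the graph induced on
`S \ (X 1 ∪ ⋯ ∪ X (i-1))`, `l` is minimal with `X 1 ∪ ⋯ ∪ X l = S`, and
`X` is `∅` outside the indices `1, …, l`. -/
def IsCanonicalSeq (E : V → V → Prop) (S : Set V) (l : ℕ) (X : ℕ → Set V) : Prop :=
  (∀ i, 1 ≤ i → i ≤ l →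
    X i = {v | v ∈ S ∧ v ∉ SeqPrev X i ∧ ∀ u ∈ S, u ∉ SeqPrev X i → ¬ E u v}) ∧
  SeqPrev X (l + 1) = S ∧
  (∀ l', l' < l → SeqPrev X (l' + 1) ≠ S) ∧
  (∀ i, i = 0 ∨ l < i → X i = ∅)

/-- The digraph induced on `S` is `M`-consistent: for every `v ∈ S` the induced
subgraph on `M ∪ {v}` is acyclic. -/
def MConsistentOn (E : V → V → Prop) (S M : Set V) : Prop :=
  ∀ v ∈ S, AcyclicOn E (M ∪ {v})

/-- `u` and `v` are `M`-equivalent. -/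
def MEquiv (E : V → V → Prop) (M : Set V) (u v : V) : Prop :=
  OutN E u ∩ M = OutN E v ∩ M ∧ InN E u ∩ M = InN E v ∩ M

/-- `v` is `(M, X i)`-equivalent: `v` is `M`-equivalent to a vertex of `X i`. -/
def MXEquiv (E : V → V → Prop) (M : Set V) (X : ℕ → Set V) (i : ℕ) (v : V) : Prop :=
  ∃ u ∈ X i, MEquiv E M v u

/-- `v` is `(M, X i)`-conflicting. -/
def MXConflict (E : V → V → Prop) (X : ℕ → Set V) (i : ℕ) (v : V) : Prop :=
  (OutN E v ∩ X i).Nonempty ∧ (InN E v ∩ X i).Nonempty ∧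
  (∀ j, j < i → OutN E v ∩ X j = ∅) ∧
  (∀ j, i < j → InN E v ∩ X j = ∅)

/-- `π` is a topological sort of the digraph induced by `E` on `S`. -/
def IsTopSortOn (E : V → V → Prop) (S : Set V) (π : V → ℕ) : Prop :=
  Set.InjOn π S ∧ ∀ u ∈ S, ∀ w ∈ S, E u w → π u < π w

/-- `v` is `M⁻`-universal (w.r.t. the canonical sequence `X` of `T[M]`). -/
def MUnivMinus (E : V → V → Prop) (M : Set V) (X : ℕ → Set V) (v : V) : Prop :=
  (∀ i, ¬ MXEquiv E M X i v) ∧ AcyclicOn E (M ∪ {v}) ∧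
  ∃ π : V → ℕ, IsTopSortOn E (M ∪ {v}) π ∧ ∀ u ∈ M ∪ {v}, u ≠ v → π v < π u

/-- `v` is `M⁺`-universal (w.r.t. the canonical sequence `X` of `T[M]`). -/
def MUnivPlus (E : V → V → Prop) (M : Set V) (X : ℕ → Set V) (v : V) : Prop :=
  (∀ i, ¬ MXEquiv E M X i v) ∧ AcyclicOn E (M ∪ {v}) ∧
  ∃ π : V → ℕ, IsTopSortOn E (M ∪ {v}) π ∧ ∀ u ∈ M ∪ {v}, u ≠ v → π u < π v

/-- `v` is `M`-universal. -/
def MUniversal (E : V → V → Prop) (M : Set V) (X : ℕ → Set V) (v : V) : Prop :=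
  MUnivMinus E M X v ∨ MUnivPlus E M X v

/-- `(X 1, Y 1, …, X l, Y l)` is the `M`-sequence of the digraph induced by `E` on
the vertex set `S`, where `X'` is the canonical sequence of `T[M]`:  `X i` is the set
of all `(M, X' i)`-equivalent vertices of `S` and `Y i` the set of all
`(M, X' i)`-conflicting vertices of `S`, with `Y 1` additionally containing every
`M⁻`-universal vertex and `Y l` every `M⁺`-universal vertex of `S`. -/
def IsMSeqOn (E : V → V → Prop) (S M : Set V) (l : ℕ) (X' X Y : ℕ → Set V) : Prop :=
  IsCanonicalSeq E M l X' ∧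
  (∀ i, 1 ≤ i → i ≤ l → X i = {w | w ∈ S ∧ MXEquiv E M X' i w}) ∧
  (∀ i, 1 ≤ i → i ≤ l → Y i =
    {w | w ∈ S ∧ MXConflict E X' i w} ∪
    (if i = 1 then {w | w ∈ S ∧ MUnivMinus E M X' w} else ∅) ∪
    (if i = l then {w | w ∈ S ∧ MUnivPlus E M X' w} else ∅)) ∧
  (∀ i, i = 0 ∨ l < i → X i = ∅ ∧ Y i = ∅)

/-- Every collection of at least `t` consecutive vertices of `π` restricted to `S`
contains a vertex of `M`. -/
def ConsecHitsOn (π : V → ℕ) (S M : Set V) (t : ℝ) : Prop :=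
  ∀ u ∈ S, ∀ w ∈ S, π u ≤ π w →
    t ≤ ({x | x ∈ S ∧ π u ≤ π x ∧ π x ≤ π w}.ncard : ℝ) →
    ∃ m ∈ M ∩ S, π u ≤ π m ∧ π m ≤ π w

/-- A feedback vertex set `H` is `M`-homogeneous: some topological sort `π` of
`T − H` is such that every `10 (log₂ k)³` consecutive vertices of `π` restricted to
`A \ H`, respectively to `B \ H`, contain a vertex of `M`. -/
def MHomogeneous (E : V → V → Prop) (A B M H : Set V) (k : ℕ) : Prop :=
  ∃ π : V → ℕ, IsTopSortOn E Hᶜ π ∧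
    ConsecHitsOn π (A \ H) M (10 * (Real.logb 2 k) ^ 3) ∧
    ConsecHitsOn π (B \ H) M (10 * (Real.logb 2 k) ^ 3)

/-- The left boundary of block `i`: vertices of `X i` occurring before the first
`M`-vertex of `X i` in the topological sort `π`. -/
def LeftBd (π : V → ℕ) (X : ℕ → Set V) (M : Set V) (i : ℕ) : Set V :=
  {x | x ∈ X i ∧ ∀ m ∈ X i ∩ M, π x < π m}

/-- The right boundary of block `i`: vertices of `X i` occurring after the last
`M`-vertex of `X i` in the topological sort `π`. -/
def RightBd (π : V → ℕ) (X : ℕ → Set V) (M : Set V) (i : ℕ) : Set V :=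
  {x | x ∈ X i ∧ ∀ m ∈ X i ∩ M, π m < π x}

/-- The vicinity of block `i`. -/
def Vicinity (π : V → ℕ) (X Y : ℕ → Set V) (M : Set V) (i : ℕ) : Set V :=
  LeftBd π X M i ∪ RightBd π X M i ∪ Y i ∪ RightBd π X M (i - 1) ∪ LeftBd π X M (i + 1)

/-- `F` is a `t`-wise independent family of functions from `V` to `{1, …, q}`. -/
def TwiseIndep (F : Finset (V → ℕ)) (t q : ℕ) : Prop :=
  F.Nonempty ∧
  (∀ f ∈ F, ∀ v : V, f v ∈ Finset.Icc 1 q) ∧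
  ∀ g : Fin t → V, Function.Injective g →
    ∀ α : Fin t → ℕ, (∀ i, α i ∈ Finset.Icc 1 q) →
      (F.filter fun f => ∀ i, f (g i) = α i).card * q ^ t = F.card

/-- `u` and `v` are false twins. -/
def FalseTwins (E : V → V → Prop) (u v : V) : Prop :=
  ¬ E u v ∧ ¬ E v u ∧ OutN E u = OutN E v ∧ InN E u = InN E v

/-- The vertex set of a quadruple (used for vertex sets of squares). -/
def quadVerts (q : V × V × V × V) : Set V := {q.1, q.2.1, q.2.2.1, q.2.2.2}

namespace IsBipartiteTournament

variable {E : V → V → Prop} {A B : Set V}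

theorem adj_iff (h : IsBipartiteTournament E A B) (u w : V) :
    (E u w ∨ E w u) ↔ ¬ (u ∈ A ↔ w ∈ A) := by
  obtain ⟨hun, hint, hx, hA, hB⟩ := h
  have key : ∀ x, x ∈ B ↔ x ∉ A := fun x => by
    have h1 : x ∈ A ∪ B := hun ▸ Set.mem_univ x
    have h2 : x ∉ A ∩ B := by simp [hint]
    simp only [Set.mem_union, Set.mem_inter_iff] at h1 h2
    tauto
  by_cases hu : u ∈ A <;> by_cases hw : w ∈ A
  · have := hA u hu w hw; have := hA w hw u hu; tauto
  · rcases hx u hu w ((key w).2 hw) with ⟨h, -⟩ | ⟨h, -⟩ <;> tauto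
  · rcases hx w hw u ((key u).2 hu) with ⟨h, -⟩ | ⟨h, -⟩ <;> tauto
  · have := hB u ((key u).2 hu) w ((key w).2 hw)
    have := hB w ((key w).2 hw) u ((key u).2 hu); tauto

theorem asymm (h : IsBipartiteTournament E A B) {u w : V} (huw : E u w) : ¬ E w u := by
  intro hwu
  have hne := (h.adj_iff u w).1 (Or.inl huw)
  obtain ⟨hun, -, hx, -, -⟩ := h
  have hu : u ∈ A ∪ B := hun ▸ Set.mem_univ u
  have hw : w ∈ A ∪ B := hun ▸ Set.mem_univ w
  simp only [Set.mem_union] at hu hw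
  by_cases hu' : u ∈ A
  · rcases hx u hu' w (by tauto) with ⟨-, h⟩ | ⟨-, h⟩ <;> tauto
  · rcases hx w (by tauto) u (by tauto) with ⟨-, h⟩ | ⟨-, h⟩ <;> tauto

end IsBipartiteTournament

namespace IsCanonicalSeq

variable {E : V → V → Prop} {A B S : Set V} {l : ℕ} {X : ℕ → Set V}

theorem mem_iff (h : IsCanonicalSeq E S l X) {i : ℕ} (h1 : 1 ≤ i) (h2 : i ≤ l) (v : V) :
    v ∈ X i ↔ v ∈ S ∧ v ∉ SeqPrev X i ∧ ∀ u ∈ S, u ∉ SeqPrev X i → ¬ E u v := by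
  conv_lhs => rw [h.1 i h1 h2]
  rfl

theorem range_of_mem (h : IsCanonicalSeq E S l X) {i : ℕ} {v : V} (hv : v ∈ X i) :
    1 ≤ i ∧ i ≤ l := by
  by_contra hc
  have := h.2.2.2 i (by omega)
  simp [this] at hv

theorem subset (h : IsCanonicalSeq E S l X) {i : ℕ} {v : V} (hv : v ∈ X i) : v ∈ S := by
  obtain ⟨h1, h2⟩ := h.range_of_mem hv
  exact ((h.mem_iff h1 h2 v).1 hv).1

theorem not_mem_prev (h : IsCanonicalSeq E S l X) {i : ℕ} {v : V} (hv : v ∈ X i) :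
    v ∉ SeqPrev X i := by
  obtain ⟨h1, h2⟩ := h.range_of_mem hv
  exact ((h.mem_iff h1 h2 v).1 hv).2.1

theorem index_unique (h : IsCanonicalSeq E S l X) {i j : ℕ} {v : V} (hi : v ∈ X i)
    (hj : v ∈ X j) : i = j := by
  rcases lt_trichotomy i j with hlt | rfl | hlt
  · exact (h.not_mem_prev hj ⟨i, (h.range_of_mem hi).1, hlt, hi⟩).elim
  · rfl
  · exact (h.not_mem_prev hi ⟨j, (h.range_of_mem hj).1, hlt, hj⟩).elim

theorem exists_index (h : IsCanonicalSeq E S l X) {v : V} (hv : v ∈ S) : ∃ i, v ∈ X i := by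
  rw [← h.2.1] at hv
  obtain ⟨i, -, -, hi⟩ := hv
  exact ⟨i, hi⟩

theorem index_lt (h : IsCanonicalSeq E S l X) {i j : ℕ} {u w : V} (hu : u ∈ X i)
    (hw : w ∈ X j) (huw : E u w) : i < j := by
  by_contra hc
  obtain ⟨h1, h2⟩ := h.range_of_mem hw
  refine ((h.mem_iff h1 h2 w).1 hw).2.2 u (h.subset hu) ?_ huw
  rintro ⟨k, -, hk, hk'⟩
  have := h.index_unique hu hk'
  omega

theorem nonempty (h : IsCanonicalSeq E S l X) {i : ℕ} (h1 : 1 ≤ i) (h2 : i ≤ l) :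
    (X i).Nonempty := by
  by_contra hc
  rw [Set.not_nonempty_iff_eq_empty] at hc
  have hprev : ∀ n, i + n ≤ l + 1 → SeqPrev X (i + n) = SeqPrev X i := by
    intro n
    induction n with
    | zero => intro _; rfl
    | succ n ih =>
      intro hn
      have ih := ih (by omega)
      have hempty : X (i + n) = ∅ := by
        rw [h.1 (i + n) (by omega) (by omega), ih, ← hc, h.1 i h1 h2]
      rw [← ih]
      ext v
      constructor
      · rintro ⟨j, hj1, hj2, hj3⟩
        refine ⟨j, hj1, ?_, hj3⟩
        rcases Nat.lt_or_ge j (i + n) with hlt | hge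
        · exact hlt
        · have : j = i + n := by omega
          simp [this, hempty] at hj3
      · rintro ⟨j, hj1, hj2, hj3⟩
        exact ⟨j, hj1, by omega, hj3⟩
  have hfin := hprev (l + 1 - i) (by omega)
  rw [show i + (l + 1 - i) = l + 1 by omega, h.2.1] at hfin
  refine h.2.2.1 (i - 1) (by omega) ?_
  rw [show i - 1 + 1 = i by omega, ← hfin]

theorem exists_arc_succ (h : IsCanonicalSeq E S l X) {i : ℕ} (h1 : 1 ≤ i) {w : V}
    (hw : w ∈ X (i + 1)) : ∃ u ∈ X i, E u w := by
  obtain ⟨-, h2⟩ := h.range_of_mem hw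
  have hwi : w ∉ X i := fun hc => by
    have := h.index_unique hc hw
    omega
  have hw' := (h.mem_iff (by omega) h2 w).1 hw
  have hprev : w ∉ SeqPrev X i := by
    rintro ⟨j, hj1, hj2, hj⟩
    exact hw'.2.1 ⟨j, hj1, by omega, hj⟩
  rw [h.mem_iff h1 (by omega)] at hwi
  have : ∃ u ∈ S, u ∉ SeqPrev X i ∧ E u w := by
    by_contra! hc
    exact hwi ⟨hw'.1, hprev, hc⟩
  obtain ⟨u, huS, hu, huw⟩ := this
  obtain ⟨k, hk⟩ := h.exists_index huS
  have hk1 := h.index_lt hk hw huw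
  have hk2 : ¬ k < i := fun hlt => hu ⟨k, (h.range_of_mem hk).1, hlt, hk⟩
  obtain rfl : k = i := by omega
  exact ⟨u, hk, huw⟩

theorem same_side (h : IsCanonicalSeq E S l X) (hT : IsBipartiteTournament E A B) {i : ℕ}
    {u w : V} (hu : u ∈ X i) (hw : w ∈ X i) : u ∈ A ↔ w ∈ A := by
  by_contra hc
  rcases (hT.adj_iff u w).2 hc with huw | hwu
  · exact lt_irrefl _ (h.index_lt hu hw huw)
  · exact lt_irrefl _ (h.index_lt hw hu hwu)

/-- The blocks of a canonical sequence alternate between the partite sets. -/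
theorem exists_side (h : IsCanonicalSeq E S l X) (hT : IsBipartiteTournament E A B) :
    ∃ q : Prop, ∀ i, ∀ w ∈ X i, w ∈ A ↔ (i % 2 = 1 ↔ q) := by
  refine ⟨∃ x ∈ X 1, x ∈ A, ?_⟩
  have key : ∀ i, ∀ w ∈ X (i + 1), w ∈ A ↔ ((i + 1) % 2 = 1 ↔ ∃ x ∈ X 1, x ∈ A) := by
    intro i
    induction i with
    | zero =>
      intro w hw
      simp only [zero_add, Nat.one_mod, true_iff]
      exact ⟨fun hwA => ⟨w, hw, hwA⟩, fun ⟨x, hx, hxA⟩ => (h.same_side hT hx hw).1 hxA⟩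
    | succ i ih =>
      intro w hw
      obtain ⟨u, hu, huw⟩ := h.exists_arc_succ (by omega) hw
      have h1 := ih u hu
      have h2 := (hT.adj_iff u w).1 (Or.inl huw)
      have h3 : (i + 1 + 1) % 2 = 1 ↔ ¬ (i + 1) % 2 = 1 := by omega
      rw [h3]
      grind
  intro i w hw
  obtain ⟨hi, -⟩ := h.range_of_mem hw
  obtain ⟨k, rfl⟩ : ∃ k, i = k + 1 := ⟨i - 1, by omega⟩
  exact key k w hw

/-- An acyclic bipartite tournament is determined by the ranks of its vertices in the
canonical sequence, and a further vertex sees precisely the blocks of one parity. -/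
theorem exists_rank (h : IsCanonicalSeq E S l X) (hT : IsBipartiteTournament E A B) (v : V) :
    ∃ (r : V → ℕ) (p : ℕ), p < 2 ∧ (∀ i u, u ∈ X i ↔ u ∈ S ∧ r u = i) ∧
      (∀ u ∈ S, 1 ≤ r u ∧ r u ≤ l) ∧
      (∀ u ∈ S, ∀ w ∈ S, E u w ↔ r u < r w ∧ r u % 2 ≠ r w % 2) ∧
      (∀ u ∈ S, (E v u ∨ E u v) ↔ r u % 2 ≠ p) := by
  classical
  obtain ⟨q, hq⟩ := h.exists_side hT
  have hex : ∀ u, ∃ i, u ∈ S → u ∈ X i := fun u => by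
    by_cases hu : u ∈ S
    · obtain ⟨i, hi⟩ := h.exists_index hu
      exact ⟨i, fun _ => hi⟩
    · exact ⟨0, fun hc => (hu hc).elim⟩
  choose r hr using hex
  refine ⟨r, if v ∈ A ↔ q then 1 else 0, by split_ifs <;> omega, ?_, ?_, ?_, ?_⟩
  · intro i u
    constructor
    · intro hu
      exact ⟨h.subset hu, h.index_unique (hr u (h.subset hu)) hu⟩
    · rintro ⟨hu, rfl⟩
      exact hr u hu
  · exact fun u hu => h.range_of_mem (hr u hu)
  · intro u hu w hw
    have h1 := hq _ u (hr u hu)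
    have h2 := hq _ w (hr w hw)
    have h3 := hT.adj_iff u w
    have h4 : r u % 2 ≠ r w % 2 ↔ ¬ (u ∈ A ↔ w ∈ A) := by
      have : r u % 2 ≠ r w % 2 ↔ ¬ (r u % 2 = 1 ↔ r w % 2 = 1) := by omega
      grind
    rw [h4, ← h3]
    constructor
    · exact fun huw => ⟨h.index_lt (hr u hu) (hr w hw) huw, Or.inl huw⟩
    · rintro ⟨hlt, huw | hwu⟩
      · exact huw
      · have := h.index_lt (hr w hw) (hr u hu) hwu
        omega
  · intro u hu
    have h1 := hq _ u (hr u hu)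
    rw [hT.adj_iff v u]
    split_ifs with hc
    · grind
    · have : r u % 2 ≠ 0 ↔ r u % 2 = 1 := by omega
      grind

end IsCanonicalSeq

/-- A rank function that increases along arcs refines to a topological sort. -/
theorem exists_isTopSortOn_of_rank [Fintype V] {E : V → V → Prop} {S : Set V} (f : V → ℕ)
    (hf : ∀ u ∈ S, ∀ w ∈ S, E u w → f u < f w) :
    ∃ π : V → ℕ, IsTopSortOn E S π ∧ ∀ u w, f u < f w → π u < π w := by
  classical
  have hlt : ∀ u w, f u < f w →
      f u * Fintype.card V + (Fintype.equivFin V u : ℕ) <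
        f w * Fintype.card V + (Fintype.equivFin V w : ℕ) := by
    intro u w huw
    have h1 := (Fintype.equivFin V u).isLt
    have h2 : (f u + 1) * Fintype.card V ≤ f w * Fintype.card V := Nat.mul_le_mul_right _ huw
    rw [Nat.add_mul] at h2
    omega
  refine ⟨fun u => f u * Fintype.card V + (Fintype.equivFin V u : ℕ), ⟨?_, ?_⟩, hlt⟩
  · intro u _ w _ huw
    have hfe : f u = f w := by
      rcases lt_trichotomy (f u) (f w) with h | h | h
      · exact absurd huw (hlt u w h).ne
      · exact h
      · exact absurd huw (hlt w u h).ne'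
    simp only [hfe, add_right_inj] at huw
    exact (Fintype.equivFin V).injective (Fin.ext huw)
  · exact fun u hu w hw huw => hlt u w (hf u hu w hw huw)

/-- The condition for `v` to belong to the `i`-th conflict class of the `M`-sequence. -/
def InConflictClass (E : V → V → Prop) (M : Set V) (l : ℕ) (X : ℕ → Set V) (i : ℕ)
    (v : V) : Prop :=
  MXConflict E X i v ∨ (i = 1 ∧ MUnivMinus E M X v) ∨ (i = l ∧ MUnivPlus E M X v)

section Classification

variable {E : V → V → Prop} {A B M : Set V} {l : ℕ} {X : ℕ → Set V} {v : V}

theorem mEquiv_iff {u w : V} :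
    MEquiv E M u w ↔ ∀ x ∈ M, (E u x ↔ E w x) ∧ (E x u ↔ E x w) := by
  simp only [MEquiv, Set.ext_iff, OutN, InN, Set.mem_inter_iff, Set.mem_ofPred_eq]
  constructor
  · intro h x hx
    have h1 := h.1 x
    have h2 := h.2 x
    tauto
  · intro h
    constructor <;> intro x <;> have := h x <;> tauto

theorem MUnivMinus.not_arc (h : MUnivMinus E M X v) (hv : v ∉ M) {u : V} (hu : u ∈ M) :
    ¬ E u v := by
  obtain ⟨-, -, π, ⟨-, hπ⟩, hfirst⟩ := h
  intro huv
  have h1 := hπ u (Or.inl hu) v (Or.inr rfl) huv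
  have h2 := hfirst u (Or.inl hu) (fun hc => hv (hc ▸ hu))
  omega

theorem MUnivPlus.not_arc (h : MUnivPlus E M X v) (hv : v ∉ M) {u : V} (hu : u ∈ M) :
    ¬ E v u := by
  obtain ⟨-, -, π, ⟨-, hπ⟩, hlast⟩ := h
  intro hvu
  have h1 := hπ v (Or.inr rfl) u (Or.inl hu) hvu
  have h2 := hlast u (Or.inl hu) (fun hc => hv (hc ▸ hu))
  omega

theorem MXEquiv.not_inConflictClass (hX : IsCanonicalSeq E M l X) {i k : ℕ}
    (h : MXEquiv E M X i v) : ¬ InConflictClass E M l X k v := by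
  rintro (⟨⟨x, hvx, hx⟩, ⟨y, hyv, hy⟩, -, -⟩ | ⟨-, h', -⟩ | ⟨-, h', -⟩)
  · obtain ⟨u, hu, huv⟩ := h
    rw [mEquiv_iff] at huv
    have h1 := hX.index_lt hu hx ((huv x (hX.subset hx)).1.1 hvx)
    have h2 := hX.index_lt hy hu ((huv y (hX.subset hy)).2.1 hyv)
    omega
  · exact h' i h
  · exact h' i h

theorem MXConflict.index_unique {i k : ℕ} (hi : MXConflict E X i v) (hk : MXConflict E X k v) :
    i = k := by
  rcases lt_trichotomy i k with h | h | h
  · exact absurd (hi.2.2.2 k h) hk.2.1.ne_empty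
  · exact h
  · exact absurd (hk.2.2.2 i h) hi.2.1.ne_empty

theorem MXEquiv.index_unique (hT : IsBipartiteTournament E A B) (hX : IsCanonicalSeq E M l X)
    {i k : ℕ} (hi : MXEquiv E M X i v) (hk : MXEquiv E M X k v) : i = k := by
  obtain ⟨r, p, -, hmem, -, harc, hadj⟩ := hX.exists_rank hT v
  have hpar : ∀ j, MXEquiv E M X j v → j % 2 = p := by
    rintro j ⟨u, hu, huv⟩
    obtain ⟨huM, rfl⟩ := (hmem j u).1 hu
    have h1 := mEquiv_iff.1 huv u huM
    have h2 := harc u huM u huM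
    have h3 := hadj u huM
    by_contra hc
    have := h3.2 hc
    have : E u u := by tauto
    exact lt_irrefl _ (h2.1 this).1
  have hlt : ∀ a b, MXEquiv E M X a v → MXEquiv E M X b v → ¬ a < b := by
    intro a b ha hb hab
    have ha' := hpar a ha
    have hb' := hpar b hb
    obtain ⟨u, hu, huv⟩ := ha
    obtain ⟨w, hw, hwv⟩ := hb
    have hrw := hX.range_of_mem hw
    obtain ⟨z, hz⟩ := hX.nonempty (i := a + 1) (by omega) (by omega)
    obtain ⟨huM, hur⟩ := (hmem _ u).1 hu
    obtain ⟨hwM, hwr⟩ := (hmem _ w).1 hw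
    obtain ⟨hzM, hzr⟩ := (hmem _ z).1 hz
    have h1 := (mEquiv_iff.1 huv z hzM).1.2 ((harc u huM z hzM).2 (by omega))
    have h2 := (mEquiv_iff.1 hwv z hzM).2.2 ((harc z hzM w hwM).2 (by omega))
    exact hT.asymm h1 h2
  have := hlt i k hi hk
  have := hlt k i hk hi
  omega

theorem MUnivMinus.not_mUnivPlus (hT : IsBipartiteTournament E A B)
    (hX : IsCanonicalSeq E M l X) (hl : 1 ≤ l) (hv : v ∉ M) (h : MUnivMinus E M X v) :
    ¬ MUnivPlus E M X v := by
  intro h'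
  obtain ⟨r, p, hp, hmem, -, harc, hadj⟩ := hX.exists_rank hT v
  obtain ⟨u, hu⟩ := hX.nonempty le_rfl hl
  obtain ⟨huM, -⟩ := (hmem _ u).1 hu
  have hpar : ∀ x ∈ M, r x % 2 = p := by
    intro x hx
    by_contra hc
    rcases (hadj x hx).2 hc with h1 | h1
    · exact h'.not_arc hv hx h1
    · exact h.not_arc hv hx h1
  refine h.1 1 ⟨u, hu, mEquiv_iff.2 fun x hx => ?_⟩
  have h1 := h.not_arc hv hx
  have h2 := h'.not_arc hv hx
  have h3 := harc u huM x hx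
  have h4 := harc x hx u huM
  have h5 := hpar x hx
  have h6 := hpar u huM
  simp only [h5, h6, ne_eq, not_true_eq_false, and_false, iff_false] at h3 h4
  tauto

theorem InConflictClass.index_unique (hT : IsBipartiteTournament E A B)
    (hX : IsCanonicalSeq E M l X) (hl : 1 ≤ l) (hv : v ∉ M) {i k : ℕ}
    (hi : InConflictClass E M l X i v) (hk : InConflictClass E M l X k v) : i = k := by
  have hminus : ∀ j, MXConflict E X j v → ¬ MUnivMinus E M X v := by
    rintro j ⟨-, ⟨y, hyv, hy⟩, -, -⟩ h
    exact h.not_arc hv (hX.subset hy) hyv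
  have hplus : ∀ j, MXConflict E X j v → ¬ MUnivPlus E M X v := by
    rintro j ⟨⟨y, hyv, hy⟩, -, -, -⟩ h
    exact h.not_arc hv (hX.subset hy) hyv
  have hpm := fun h : MUnivMinus E M X v => h.not_mUnivPlus hT hX hl hv
  rcases hi with hi | ⟨hi, hi'⟩ | ⟨hi, hi'⟩ <;> rcases hk with hk | ⟨hk, hk'⟩ | ⟨hk, hk'⟩
  · exact hi.index_unique hk
  · exact (hminus _ hi hk').elim
  · exact (hplus _ hi hk').elim
  · exact (hminus _ hk hi').elim
  · omega
  · exact (hpm hi' hk').elim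
  · exact (hplus _ hk hi').elim
  · exact (hpm hk' hi').elim
  · omega

theorem exists_mXEquiv_or_inConflictClass [Fintype V] (hT : IsBipartiteTournament E A B)
    (hX : IsCanonicalSeq E M l X) (hl : 1 ≤ l) (hv : v ∉ M) (hac : AcyclicOn E (M ∪ {v})) :
    ∃ i, 1 ≤ i ∧ i ≤ l ∧ (MXEquiv E M X i v ∨ InConflictClass E M l X i v) := by
  classical
  obtain ⟨r, p, hp, hmem, hrange, harc, hadj⟩ := hX.exists_rank hT v
  have hne : ∀ i, 1 ≤ i → i ≤ l → ∃ u ∈ M, r u = i := fun i h1 h2 => by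
    obtain ⟨u, hu⟩ := hX.nonempty h1 h2
    exact ⟨u, (hmem i u).1 hu⟩
  have hvv : ¬ E v v := fun h => hT.asymm h h
  have hmono : ∀ x ∈ M, ∀ y ∈ M, E v x → E y v → r y ≤ r x := by
    intro x hx y hy hvx hyv
    by_contra! hlt
    have hxp := (hadj x hx).1 (Or.inl hvx)
    have hyp := (hadj y hy).1 (Or.inr hyv)
    have := hrange y hy
    obtain ⟨z, hz, hzr⟩ := hne (r x + 1) (by omega) (by omega)
    have hxz := (harc x hx z hz).2 (by omega)
    have hzy := (harc z hz y hy).2 (by omega)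
    exact hac v <| (((Relation.TransGen.single ⟨Or.inr rfl, Or.inl hx, hvx⟩).tail
      ⟨Or.inl hx, Or.inl hz, hxz⟩).tail ⟨Or.inl hz, Or.inl hy, hzy⟩).tail
      ⟨Or.inl hy, Or.inr rfl, hyv⟩
  by_cases hmix : ∃ x ∈ M, ∃ y ∈ M, E v x ∧ E y v ∧ r x = r y
  · obtain ⟨x, hx, y, hy, hvx, hyv, hxy⟩ := hmix
    refine ⟨r x, (hrange x hx).1, (hrange x hx).2, Or.inr (Or.inl
      ⟨⟨x, hvx, (hmem _ _).2 ⟨hx, rfl⟩⟩, ⟨y, hyv, (hmem _ _).2 ⟨hy, hxy.symm⟩⟩, ?_, ?_⟩)⟩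
    · intro j hj
      rw [Set.eq_empty_iff_forall_notMem]
      rintro w ⟨hvw, hw⟩
      obtain ⟨hwM, rfl⟩ := (hmem _ w).1 hw
      have := hmono w hwM y hy hvw hyv
      omega
    · intro j hj
      rw [Set.eq_empty_iff_forall_notMem]
      rintro w ⟨hwv, hw⟩
      obtain ⟨hwM, rfl⟩ := (hmem _ w).1 hw
      have := hmono x hx w hwM hvx hwv
      omega
  have hstrict : ∀ x ∈ M, ∀ y ∈ M, E v x → E y v → r y < r x := by
    intro x hx y hy hvx hyv
    refine lt_of_le_of_ne (hmono x hx y hy hvx hyv) fun h => hmix ⟨x, hx, y, hy, hvx, hyv, h.symm⟩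
  by_cases hin : ∃ y ∈ M, E y v
  · obtain ⟨y, ⟨hy, hyv⟩, hmax⟩ := Set.exists_max_image {y | y ∈ M ∧ E y v} r
      (Set.toFinite _) hin
    have hyp := (hadj y hy).1 (Or.inr hyv)
    obtain ⟨hy1, hyl⟩ := hrange y hy
    rcases hyl.lt_or_eq with hlt | heq
    · obtain ⟨u, hu, hur⟩ := hne (r y + 1) (by omega) (by omega)
      refine ⟨r y + 1, by omega, by omega, Or.inl ⟨u, (hmem _ u).2 ⟨hu, hur⟩,
        mEquiv_iff.2 fun x hx => ?_⟩⟩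
      rw [harc u hu x hx, harc x hx u hu]
      have h1 := hadj x hx
      have h2 := fun h => hstrict x hx y hy h hyv
      have h3 := fun h => hmax x ⟨hx, h⟩
      constructor <;> constructor
      · intro h
        have := h2 h
        have := h1.1 (Or.inl h)
        omega
      · intro h
        rcases h1.2 (by omega) with h4 | h4
        · exact h4
        · have := h3 h4
          omega
      · intro h
        have := h3 h
        have := h1.1 (Or.inr h)
        omega
      · intro h
        rcases h1.2 (by omega) with h4 | h4
        · have := h2 h4
          omega
        · exact h4
    · have hout : ∀ x ∈ M, ¬ E v x := fun x hx h => by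
        have := hstrict x hx y hy h hyv
        have := hrange x hx
        omega
      refine ⟨l, hl, le_rfl, Or.inr (Or.inr (Or.inr ⟨rfl, ?_, hac, ?_⟩))⟩
      · rintro i ⟨u, hu, huv⟩
        obtain ⟨huM, hur⟩ := (hmem _ u).1 hu
        have h1 := mEquiv_iff.1 huv y hy
        have h2 := (harc y hy u huM).1 (h1.2.1 hyv)
        have := hrange u huM
        omega
      · have hf : ∀ x ∈ M, (if x = v then l + 1 else r x) = r x := fun x hx =>
          if_neg fun h : x = v => hv (h ▸ hx)
        obtain ⟨π, hπ, hπ'⟩ := exists_isTopSortOn_of_rank (E := E) (S := M ∪ {v})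
          (fun x => if x = v then l + 1 else r x) (by
            rintro x (hx | rfl) w (hw | rfl) hxw
            · simp only [hf x hx, hf w hw]
              exact ((harc x hx w hw).1 hxw).1
            · simp only [hf x hx, if_true]
              have := hrange x hx
              omega
            · exact (hout w hw hxw).elim
            · exact (hvv hxw).elim)
        refine ⟨π, hπ, ?_⟩
        rintro u (hu | rfl) huv
        · apply hπ'
          have := hrange u hu
          simp only [hf u hu, if_true]
          omega
        · exact (huv rfl).elim
  · push Not at hin
    by_cases hp1 : p = 1
    · obtain ⟨u, hu, hur⟩ := hne 1 le_rfl hl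
      refine ⟨1, le_rfl, hl, Or.inl ⟨u, (hmem _ u).2 ⟨hu, hur⟩, mEquiv_iff.2 fun x hx => ?_⟩⟩
      rw [harc u hu x hx, harc x hx u hu]
      have h1 := hadj x hx
      have h2 := hin x hx
      have h3 := hrange x hx
      simp only [h2, or_false] at h1
      rw [h1]
      simp only [h2, false_iff]
      omega
    · refine ⟨1, le_rfl, hl, Or.inr (Or.inr (Or.inl ⟨rfl, ?_, hac, ?_⟩))⟩
      · rintro i ⟨u, hu, huv⟩
        obtain ⟨huM, hur⟩ := (hmem _ u).1 hu
        obtain ⟨x, hx, hxr⟩ := hne 1 le_rfl hl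
        have h1 := mEquiv_iff.1 huv x hx
        have h2 := ((hadj x hx).2 (by omega)).resolve_right (hin x hx)
        have h3 := (harc u huM x hx).1 (h1.1.1 h2)
        have := hrange u huM
        omega
      · have hf : ∀ x ∈ M, (if x = v then 0 else r x) = r x := fun x hx =>
          if_neg fun h : x = v => hv (h ▸ hx)
        obtain ⟨π, hπ, hπ'⟩ := exists_isTopSortOn_of_rank (E := E) (S := M ∪ {v})
          (fun x => if x = v then 0 else r x) (by
            rintro x (hx | rfl) w (hw | rfl) hxw
            · simp only [hf x hx, hf w hw]
              exact ((harc x hx w hw).1 hxw).1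
            · exact (hin x hx hxw).elim
            · simp only [hf w hw, if_true]
              have := hrange w hw
              omega
            · exact (hvv hxw).elim)
        refine ⟨π, hπ, ?_⟩
        rintro u (hu | rfl) huv
        · apply hπ'
          have := hrange u hu
          simp only [hf u hu, if_true]
          omega
        · exact (huv rfl).elim

end Classification

theorem isMSeqOn_iff {E : V → V → Prop} {S M : Set V} {l : ℕ} {X' X Y : ℕ → Set V} :
    IsMSeqOn E S M l X' X Y ↔ IsCanonicalSeq E M l X' ∧
      (∀ i, 1 ≤ i → i ≤ l → ∀ w, w ∈ X i ↔ w ∈ S ∧ MXEquiv E M X' i w) ∧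
      (∀ i, 1 ≤ i → i ≤ l → ∀ w, w ∈ Y i ↔ w ∈ S ∧ InConflictClass E M l X' i w) ∧
      (∀ i, i = 0 ∨ l < i → X i = ∅ ∧ Y i = ∅) := by
  have key : ∀ i w, w ∈ {w | w ∈ S ∧ MXConflict E X' i w} ∪
      (if i = 1 then {w | w ∈ S ∧ MUnivMinus E M X' w} else ∅) ∪
      (if i = l then {w | w ∈ S ∧ MUnivPlus E M X' w} else ∅) ↔
      w ∈ S ∧ InConflictClass E M l X' i w := by
    intro i w
    unfold InConflictClass
    split_ifs <;> simp_all <;> tauto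
  simp only [IsMSeqOn, Set.ext_iff, key, Set.mem_ofPred_eq]

theorem stmt_10 [Fintype V] (E : V → V → Prop) (A B : Set V)
    (hT' : IsBipartiteTournament E A B) (v : V) (M : Set V) (hM : M ⊆ {v}ᶜ)
    (hcons : MConsistentOn E {v}ᶜ M) (hcons' : MConsistentOn E Set.univ M)
    (l : ℕ) (hl : 1 ≤ l) (X' X Y : ℕ → Set V)
    (hseq : IsMSeqOn E {v}ᶜ M l X' X Y) :
    ∃ i, 1 ≤ i ∧ i ≤ l ∧
      (IsMSeqOn E Set.univ M l X' (Function.update X i (X i ∪ {v})) Y ∨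
       IsMSeqOn E Set.univ M l X' X (Function.update Y i (Y i ∪ {v}))) := by
  have hv : v ∉ M := fun h => hM h rfl
  simp only [isMSeqOn_iff] at hseq ⊢
  obtain ⟨hX', hX, hY, hout⟩ := hseq
  have extend : ∀ (P : ℕ → V → Prop) (Z : ℕ → Set V) (i : ℕ),
      (∀ k, 1 ≤ k → k ≤ l → ∀ w, w ∈ Z k ↔ w ∈ ({v}ᶜ : Set V) ∧ P k w) →
      P i v → (∀ k, P k v → i = k) →
      ∀ k, 1 ≤ k → k ≤ l → ∀ w,
        w ∈ Function.update Z i (Z i ∪ {v}) k ↔ w ∈ Set.univ ∧ P k w := by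
    intro P Z i hZ hi huniq k hk1 hk2 w
    rcases eq_or_ne k i with rfl | hki
    · rw [Function.update_self]
      rcases eq_or_ne w v with rfl | hwv
      · simpa using hi
      · simp [hZ k hk1 hk2, hwv]
    · rw [Function.update_of_ne hki, hZ k hk1 hk2]
      rcases eq_or_ne w v with rfl | hwv
      · simpa using fun h => hki (huniq k h).symm
      · simp [hwv]
  have keep : ∀ (P : ℕ → V → Prop) (Z : ℕ → Set V),
      (∀ k, 1 ≤ k → k ≤ l → ∀ w, w ∈ Z k ↔ w ∈ ({v}ᶜ : Set V) ∧ P k w) →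
      (∀ k, ¬ P k v) →
      ∀ k, 1 ≤ k → k ≤ l → ∀ w, w ∈ Z k ↔ w ∈ Set.univ ∧ P k w := by
    intro P Z hZ hnot k hk1 hk2 w
    rw [hZ k hk1 hk2]
    rcases eq_or_ne w v with rfl | hwv
    · simpa using hnot k
    · simp [hwv]
  obtain ⟨i, hi1, hil, h | h⟩ := exists_mXEquiv_or_inConflictClass hT' hX' hl hv
    (hcons' v (Set.mem_univ v))
  · refine ⟨i, hi1, hil, Or.inl ⟨hX',
      extend _ X i hX h fun k hk => h.index_unique hT' hX' hk,
      keep _ Y hY fun k => h.not_inConflictClass hX', fun k hk => ?_⟩⟩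
    rw [Function.update_of_ne (by omega)]
    exact hout k hk
  · refine ⟨i, hi1, hil, Or.inr ⟨hX',
      keep _ X hX fun k hk => hk.not_inConflictClass hX' h,
      extend _ Y i hY h fun k hk => h.index_unique hT' hX' hl hv hk, fun k hk => ?_⟩⟩
    rw [Function.update_of_ne (by omega)]
    exact hout k hk
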